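/- Let 0 < ζ ≤ η and define τ̃₂(ω) := (−(ζ + ηω) + √((ζ + ηω)² − 4ζ²ω)) / (2ζω) for ω > 0. Then ω ↦ τ̃₂(ω) is nondecreasing on (0,∞). Consequently, since 1 + τ̃₂(ω) ≥ 0, the function ω ↦ (1 + τ̃₂(ω))² is nondecreasing in ω; in particular, for fixed φ > 0, the ridgeless asymptotic bias B(ψ) := (1 + τ̃₂(max{φ, ψ}))² is a nondecreasing function of ψ, i.e. the bias is non-increasing in the width n₁ (equivalently, non-increasing in the overparameterization ratio n₁/m = φ/ψ). -/

import Mathlib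

/-- The number `2ζ` bounds the larger root of `y² - 2(ζ + ηω)y + 4ζ²ω` from below. -/
lemma two_mul_le_add_sqrt {ζ η ω : ℝ} (hζ : 0 < ζ) (hζη : ζ ≤ η) (hω : 0 < ω) :
    2 * ζ ≤ (ζ + η * ω) + Real.sqrt ((ζ + η * ω) ^ 2 - 4 * ζ ^ 2 * ω) := by
  have h : ζ - η * ω ≤ Real.sqrt ((ζ + η * ω) ^ 2 - 4 * ζ ^ 2 * ω) := by
    apply Real.le_sqrt_of_sq_le
    have : 0 ≤ ζ * ω * (η - ζ) := mul_nonneg (by positivity) (by linarith)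
    nlinarith
  linarith

lemma sq_sqrt_discrim {ζ η ω : ℝ} (hζ : 0 < ζ) (hζη : ζ ≤ η) (hω : 0 < ω) :
    Real.sqrt ((ζ + η * ω) ^ 2 - 4 * ζ ^ 2 * ω) ^ 2 = (ζ + η * ω) ^ 2 - 4 * ζ ^ 2 * ω := by
  apply Real.sq_sqrt
  have : 0 ≤ ζ * ω * (η - ζ) := mul_nonneg (by positivity) (by linarith)
  nlinarith [sq_nonneg (ζ - η * ω)]

lemma monotoneOn_add_sqrt {ζ η : ℝ} (hζ : 0 < ζ) (hζη : ζ ≤ η) :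
    MonotoneOn (fun ω => (ζ + η * ω) + Real.sqrt ((ζ + η * ω) ^ 2 - 4 * ζ ^ 2 * ω))
      (Set.Ioi (0 : ℝ)) := by
  intro a ha b _ hab
  have hlow := two_mul_le_add_sqrt hζ hζη ha
  have hsq := sq_sqrt_discrim hζ hζη ha
  dsimp only
  set s := Real.sqrt ((ζ + η * a) ^ 2 - 4 * ζ ^ 2 * a)
  have hy : 2 * ζ ^ 2 ≤ η * ((ζ + η * a) + s) := by
    nlinarith [mul_le_mul hζη hlow (by positivity) (hζ.le.trans hζη)]
  have h : (ζ + η * a) + s - (ζ + η * b) ≤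
      Real.sqrt ((ζ + η * b) ^ 2 - 4 * ζ ^ 2 * b) := by
    apply Real.le_sqrt_of_sq_le
    nlinarith [mul_nonneg (sub_nonneg.2 hab) (sub_nonneg.2 hy)]
  linarith

lemma root_eq_neg_div_add_sqrt {ζ η ω : ℝ} (hζ : 0 < ζ) (hζη : ζ ≤ η) (hω : 0 < ω) :
    (-(ζ + η * ω) + Real.sqrt ((ζ + η * ω) ^ 2 - 4 * ζ ^ 2 * ω)) / (2 * ζ * ω) =
      -(2 * ζ / ((ζ + η * ω) + Real.sqrt ((ζ + η * ω) ^ 2 - 4 * ζ ^ 2 * ω))) := by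
  have hlow := two_mul_le_add_sqrt hζ hζη hω
  have hsq := sq_sqrt_discrim hζ hζη hω
  set s := Real.sqrt ((ζ + η * ω) ^ 2 - 4 * ζ ^ 2 * ω)
  have hpos : 0 < (ζ + η * ω) + s := by linarith
  rw [← neg_div, div_eq_div_iff (by positivity) hpos.ne']
  linear_combination hsq

/-- **Monotonicity of the ridgeless bias** (SM, proof of Corollary 1): for `0 < ζ ≤ η`, the root
`τ̃₂(ω)` is nondecreasing on `(0,∞)`, hence `ω ↦ (1+τ̃₂(ω))²` is nondecreasing, and for fixed
`φ > 0` the ridgeless asymptotic bias `B(ψ) = (1 + τ̃₂(max φ ψ))²` is nondecreasing in `ψ`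
(equivalently, the bias is non-increasing in the width `n₁`, i.e. in the ratio `n₁/m = φ/ψ`). -/
theorem stmt18 (ζ η : ℝ) (hζ : 0 < ζ) (hζη : ζ ≤ η) :
    let t : ℝ → ℝ := fun ω =>
      (-(ζ + η * ω) + Real.sqrt ((ζ + η * ω) ^ 2 - 4 * ζ ^ 2 * ω)) / (2 * ζ * ω)
    MonotoneOn t (Set.Ioi (0 : ℝ)) ∧
    (∀ ω : ℝ, 0 < ω → 0 ≤ 1 + t ω) ∧
    MonotoneOn (fun ω => (1 + t ω) ^ 2) (Set.Ioi (0 : ℝ)) ∧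
    (∀ φ : ℝ, 0 < φ → MonotoneOn (fun ψ => (1 + t (max φ ψ)) ^ 2) (Set.Ioi (0 : ℝ))) := by
  intro t
  have ht : ∀ ω : ℝ, 0 < ω →
      t ω = -(2 * ζ / ((ζ + η * ω) + Real.sqrt ((ζ + η * ω) ^ 2 - 4 * ζ ^ 2 * ω))) :=
    fun ω hω => root_eq_neg_div_add_sqrt hζ hζη hω
  have hmono : MonotoneOn t (Set.Ioi (0 : ℝ)) := by
    intro a ha b hb hab
    rw [ht a ha, ht b hb]
    have hlow := two_mul_le_add_sqrt hζ hζη ha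
    exact neg_le_neg (div_le_div_of_nonneg_left (by positivity) (by linarith)
      (monotoneOn_add_sqrt hζ hζη ha hb hab))
  have hnonneg : ∀ ω : ℝ, 0 < ω → 0 ≤ 1 + t ω := by
    intro ω hω
    have hlow := two_mul_le_add_sqrt hζ hζη hω
    rw [ht ω hω]
    linarith [(div_le_one (by linarith)).2 hlow]
  have hsq : MonotoneOn (fun ω => (1 + t ω) ^ 2) (Set.Ioi (0 : ℝ)) := fun a ha b hb hab =>
    pow_le_pow_left₀ (hnonneg a ha) (by linarith [hmono ha hb hab]) 2
  exact ⟨hmono, hnonneg, hsq, fun φ hφ a _ b _ hab =>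
    hsq (lt_max_of_lt_left hφ) (lt_max_of_lt_left hφ) (max_le_max_left φ hab)⟩
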